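/- For every p ∈ ℝ and every r > 0, the second cosine Fourier coefficient is given by the explicit integral formula a₂(p,r) = 2·Mf(p,r) + ∫_{0}^{r} [ −(4u/r²)·Mf(p,u) − 2·r·(u/r)·(1 − (u/r)²)·∂²(Mf)/∂p² (p,u) ] du. -/

import Mathlib

open MeasureTheory Real Filter Finset

/-- Circular mean of `f` over the circle of radius `r` centered at `(p, 0)` on the x-axis:
`Mf(p,r) = (1/(2π)) ∫_{-π}^{π} f(p - r sin φ, r cos φ) dφ`. -/
noncomputable def circMean (f : ℝ × ℝ → ℝ) (p r : ℝ) : ℝ :=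
  (1 / (2 * Real.pi)) * ∫ φ in (-Real.pi)..Real.pi, f (p - r * Real.sin φ, r * Real.cos φ)

/-- `k`-th cosine Fourier coefficient of the restriction of `f` to the circle of
radius `r` centered at `(p, 0)`. -/
noncomputable def fourierA (f : ℝ × ℝ → ℝ) (k : ℕ) (p r : ℝ) : ℝ :=
  (1 / Real.pi) * ∫ φ in (-Real.pi)..Real.pi,
    f (p - r * Real.sin φ, r * Real.cos φ) * Real.cos (k * φ)

/-- `k`-th sine Fourier coefficient of the restriction of `f` to the circle of
radius `r` centered at `(p, 0)`. -/
noncomputable def fourierB (f : ℝ × ℝ → ℝ) (k : ℕ) (p r : ℝ) : ℝ :=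
  (1 / Real.pi) * ∫ φ in (-Real.pi)..Real.pi,
    f (p - r * Real.sin φ, r * Real.cos φ) * Real.sin (k * φ)

theorem hasDerivAt_intervalIntegral_of_continuous {F F' : ℝ → ℝ → ℝ} {a b : ℝ}
    (hF : Continuous (Function.uncurry F)) (hF' : Continuous (Function.uncurry F'))
    (h : ∀ x t, HasDerivAt (fun y => F y t) (F' x t) x) (x : ℝ) :
    HasDerivAt (fun y => ∫ t in a..b, F y t) (∫ t in a..b, F' x t) x := by
  obtain ⟨C, hC⟩ := ((isCompact_closedBall x 1).prod
    (isCompact_uIcc (a := a) (b := b))).exists_bound_of_continuousOn hF'.continuousOn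
  have hFx : ∀ y, Continuous (F y) := fun y => by
    exact hF.comp (f := fun t => (y, t)) (by fun_prop)
  have hFx' : ∀ y, Continuous (F' y) := fun y => by
    exact hF'.comp (f := fun t => (y, t)) (by fun_prop)
  refine (intervalIntegral.hasDerivAt_integral_of_dominated_loc_of_deriv_le
    (bound := fun _ => C) (s := Metric.closedBall x 1) (F' := F')
    (Metric.closedBall_mem_nhds x one_pos) ?_ ?_ ?_ ?_ ?_ ?_).2
  · exact Eventually.of_forall fun y => (hFx y).aestronglyMeasurable
  · exact (hFx x).intervalIntegrable a b
  · exact (hFx' x).aestronglyMeasurable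
  · exact Eventually.of_forall fun t ht y hy => hC (y, t) ⟨hy, Set.uIoc_subset_uIcc ht⟩
  · exact continuous_const.intervalIntegrable a b
  · exact Eventually.of_forall fun t _ y _ => h y t

theorem hasDerivAt_comp_prodMk {g : ℝ × ℝ → ℝ} (hg : Differentiable ℝ g) {a b : ℝ → ℝ}
    {a' b' t : ℝ} (ha : HasDerivAt a a' t) (hb : HasDerivAt b b' t) :
    HasDerivAt (fun t => g (a t, b t))
      (a' * fderiv ℝ g (a t, b t) (1, 0) + b' * fderiv ℝ g (a t, b t) (0, 1)) t := by
  have h := (hg (a t, b t)).hasFDerivAt.comp_hasDerivAt t (ha.prodMk hb)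
  have e : ((a', b') : ℝ × ℝ) = a' • ((1, 0) : ℝ × ℝ) + b' • ((0, 1) : ℝ × ℝ) := by simp
  rw [e, map_add, map_smul, map_smul] at h
  exact h

/-- Differentiating a weighted integral over a circle in the radius. -/
theorem hasDerivAt_circle_integral_radius {g : ℝ × ℝ → ℝ} (hg : ContDiff ℝ 1 g) {w : ℝ → ℝ}
    (hw : Continuous w) (a b p u : ℝ) :
    HasDerivAt (fun u => ∫ φ in a..b, g (p - u * sin φ, u * cos φ) * w φ)
      (∫ φ in a..b, (-sin φ * fderiv ℝ g (p - u * sin φ, u * cos φ) (1, 0)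
        + cos φ * fderiv ℝ g (p - u * sin φ, u * cos φ) (0, 1)) * w φ) u := by
  have hg0 := hg.continuous
  have hg1 := hg.continuous_fderiv one_ne_zero
  refine hasDerivAt_intervalIntegral_of_continuous
    (F := fun u φ => g (p - u * sin φ, u * cos φ) * w φ)
    (F' := fun u φ => (-sin φ * fderiv ℝ g (p - u * sin φ, u * cos φ) (1, 0)
        + cos φ * fderiv ℝ g (p - u * sin φ, u * cos φ) (0, 1)) * w φ) ?_ ?_ ?_ u
  · simp only [Function.uncurry_def]; fun_prop
  · simp only [Function.uncurry_def]; fun_prop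
  · intro u φ
    refine (hasDerivAt_comp_prodMk (hg.differentiable one_ne_zero) ?_ ?_).mul_const (w φ)
    · simpa using ((hasDerivAt_id u).mul_const (sin φ)).const_sub p
    · simpa using (hasDerivAt_id u).mul_const (cos φ)

/-- Differentiating an integral over a circle in the center. -/
theorem hasDerivAt_circle_integral_center {g : ℝ × ℝ → ℝ} (hg : ContDiff ℝ 1 g)
    (a b p u : ℝ) :
    HasDerivAt (fun p => ∫ φ in a..b, g (p - u * sin φ, u * cos φ))
      (∫ φ in a..b, fderiv ℝ g (p - u * sin φ, u * cos φ) (1, 0)) p := by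
  have hg0 := hg.continuous
  have hg1 := hg.continuous_fderiv one_ne_zero
  refine hasDerivAt_intervalIntegral_of_continuous
    (F := fun p φ => g (p - u * sin φ, u * cos φ))
    (F' := fun p φ => fderiv ℝ g (p - u * sin φ, u * cos φ) (1, 0)) ?_ ?_ ?_ p
  · simp only [Function.uncurry_def]; fun_prop
  · simp only [Function.uncurry_def]; fun_prop
  · intro p φ
    have h := hasDerivAt_comp_prodMk (hg.differentiable one_ne_zero)
      ((hasDerivAt_id p).sub_const (u * sin φ)) (hasDerivAt_const p (u * cos φ))
    simpa using h

/-- Integration by parts on a circle. -/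
theorem circle_integral_mul_deriv {g : ℝ × ℝ → ℝ} (hg : ContDiff ℝ 1 g) {w w' : ℝ → ℝ}
    (hw : ∀ φ, HasDerivAt w (w' φ) φ) (hw' : Continuous w') (hper : w (-π) = w π) (p u : ℝ) :
    ∫ φ in (-π)..π, g (p - u * sin φ, u * cos φ) * w' φ =
      u * ∫ φ in (-π)..π, (cos φ * fderiv ℝ g (p - u * sin φ, u * cos φ) (1, 0)
        + sin φ * fderiv ℝ g (p - u * sin φ, u * cos φ) (0, 1)) * w φ := by
  have hg1 := hg.continuous_fderiv one_ne_zero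
  have h := intervalIntegral.integral_mul_deriv_eq_deriv_mul (a := -π) (b := π)
    (u := fun φ => g (p - u * sin φ, u * cos φ)) (v := w) (v' := w')
    (fun φ _ => hasDerivAt_comp_prodMk (hg.differentiable one_ne_zero)
      (((hasDerivAt_sin φ).const_mul u).const_sub p) ((hasDerivAt_cos φ).const_mul u))
    (fun φ _ => hw φ)
    (Continuous.intervalIntegrable (by fun_prop) _ _) (hw'.intervalIntegrable _ _)
  rw [h, hper, ← intervalIntegral.integral_const_mul]
  simp only [sin_neg, sin_pi, cos_neg, cos_pi, neg_zero, sub_self, zero_sub]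
  rw [← intervalIntegral.integral_neg]
  congr 1
  ext φ
  ring

theorem iteratedDeriv_two_circMean {f : ℝ × ℝ → ℝ} (hf : ContDiff ℝ 2 f) (p u : ℝ) :
    iteratedDeriv 2 (fun p' => circMean f p' u) p =
      (1 / (2 * π)) * ∫ φ in (-π)..π,
        fderiv ℝ (fun q => fderiv ℝ f q (1, 0)) (p - u * sin φ, u * cos φ) (1, 0) := by
  have hfx : ContDiff ℝ 1 (fun q => fderiv ℝ f q (1, 0)) :=
    (hf.fderiv_right (m := 1) (by norm_num)).clm_apply contDiff_const
  have h1 : deriv (fun p' => circMean f p' u) = fun p' =>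
      (1 / (2 * π)) * ∫ φ in (-π)..π, fderiv ℝ f (p' - u * sin φ, u * cos φ) (1, 0) := by
    ext p'
    exact ((hasDerivAt_circle_integral_center (hf.of_le (by norm_num)) _ _ p' u).const_mul _).deriv
  rw [iteratedDeriv_succ, iteratedDeriv_one, h1]
  exact ((hasDerivAt_circle_integral_center hfx _ _ p u).const_mul _).deriv

/-- Explicit integral formula for the second cosine coefficient:
`a₂(p,r) = 2 Mf(p,r) + ∫_0^r [-(4u/r²) Mf(p,u) - 2r(u/r)(1-(u/r)²) ∂²(Mf)/∂p² (p,u)] du`. -/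
theorem a_two_formula (f : ℝ × ℝ → ℝ) (hf : ContDiff ℝ (⊤ : ℕ∞) f)
    (hfc : HasCompactSupport f) (hfs : tsupport f ⊆ {q : ℝ × ℝ | 0 < q.2})
    (p r : ℝ) (hr : 0 < r) :
    fourierA f 2 p r
      = 2 * circMean f p r +
        ∫ u in (0:ℝ)..r,
          (-(4 * u / r ^ 2) * circMean f p u
            - 2 * r * (u / r) * (1 - (u / r) ^ 2)
              * iteratedDeriv 2 (fun p' => circMean f p' u) p) := by
  have hf2 : ContDiff ℝ 2 f := hf.of_le (WithTop.coe_le_coe.2 le_top)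
  have hf1 : ContDiff ℝ 1 f := hf2.of_le (by norm_num)
  have hfx : ContDiff ℝ 1 (fun q => fderiv ℝ f q (1, 0)) :=
    (hf2.fderiv_right (m := 1) (by norm_num)).clm_apply contDiff_const
  have hcont0 := hf.continuous
  have hcont1 := hf1.continuous_fderiv one_ne_zero
  have hcont2 := hfx.continuous_fderiv one_ne_zero
  simp only [iteratedDeriv_two_circMean hf2]
  unfold fourierA circMean
  set A : ℝ → ℝ := fun u => ∫ φ in (-π)..π, f (p - u * sin φ, u * cos φ) * cos (2 * φ) with hA
  set F : ℝ → ℝ := fun u => ∫ φ in (-π)..π, f (p - u * sin φ, u * cos φ) with hF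
  set G : ℝ → ℝ := fun u =>
    ∫ φ in (-π)..π, fderiv ℝ f (p - u * sin φ, u * cos φ) (1, 0) * -sin φ with hG
  set K : ℝ → ℝ := fun u => ∫ φ in (-π)..π,
    fderiv ℝ (fun q => fderiv ℝ f q (1, 0)) (p - u * sin φ, u * cos φ) (1, 0) with hK
  have dA := fun u => hasDerivAt_circle_integral_radius hf1
    (w := fun φ => cos (2 * φ)) (by fun_prop) (-π) π p u
  have dF := fun u => hasDerivAt_circle_integral_radius hf1
    (w := fun _ => 1) (by fun_prop) (-π) π p u
  simp only [mul_one] at dF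
  have dG := fun u => hasDerivAt_circle_integral_radius hfx
    (w := fun φ => -sin φ) (by fun_prop) (-π) π p u
  have byPartsA := fun u => circle_integral_mul_deriv hf1 (w := fun φ => sin φ * cos φ)
    (w' := fun φ => cos (2 * φ)) (fun φ => by
      refine ((hasDerivAt_sin φ).mul (hasDerivAt_cos φ)).congr_deriv ?_
      rw [cos_two_mul']; ring) (by fun_prop) (by simp) p u
  have byPartsG := fun u => circle_integral_mul_deriv hfx (w := cos)
    (w' := fun φ => -sin φ) hasDerivAt_cos (by fun_prop) (by simp) p u
  have relA : ∀ u, 2 * A u + u * (∫ φ in (-π)..π,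
      (-sin φ * fderiv ℝ f (p - u * sin φ, u * cos φ) (1, 0)
        + cos φ * fderiv ℝ f (p - u * sin φ, u * cos φ) (0, 1)) * cos (2 * φ))
      = u * (∫ φ in (-π)..π, (-sin φ * fderiv ℝ f (p - u * sin φ, u * cos φ) (1, 0)
        + cos φ * fderiv ℝ f (p - u * sin φ, u * cos φ) (0, 1))) - 2 * u * G u := by
    intro u
    simp only [hA, hG]
    rw [byPartsA u]
    simp only [← intervalIntegral.integral_const_mul]
    rw [← intervalIntegral.integral_add (Continuous.intervalIntegrable (by fun_prop) _ _)
      (Continuous.intervalIntegrable (by fun_prop) _ _),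
      ← intervalIntegral.integral_sub (Continuous.intervalIntegrable (by fun_prop) _ _)
      (Continuous.intervalIntegrable (by fun_prop) _ _)]
    congr 1
    ext φ
    rw [cos_two_mul]
    linear_combination (2 * u * cos φ * fderiv ℝ f (p - u * sin φ, u * cos φ) (0, 1)) *
      sin_sq_add_cos_sq φ
  have relG : ∀ u, G u + u * (∫ φ in (-π)..π,
      (-sin φ * fderiv ℝ (fun q => fderiv ℝ f q (1, 0)) (p - u * sin φ, u * cos φ) (1, 0)
        + cos φ * fderiv ℝ (fun q => fderiv ℝ f q (1, 0)) (p - u * sin φ, u * cos φ) (0, 1))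
        * -sin φ) = u * K u := by
    intro u
    simp only [hG, hK]
    rw [byPartsG u]
    simp only [← intervalIntegral.integral_const_mul]
    rw [← intervalIntegral.integral_add (Continuous.intervalIntegrable (by fun_prop) _ _)
      (Continuous.intervalIntegrable (by fun_prop) _ _)]
    congr 1
    ext φ
    linear_combination
      (u * fderiv ℝ (fun q => fderiv ℝ f q (1, 0)) (p - u * sin φ, u * cos φ) (1, 0)) *
        sin_sq_add_cos_sq φ
  have hFc : Continuous F := continuous_iff_continuousAt.2 fun u => (dF u).continuousAt
  have hKc : Continuous K :=
    intervalIntegral.continuous_parametric_intervalIntegral_of_continuous' (by fun_prop) _ _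
  have hr0 : r ≠ 0 := hr.ne'
  have hprim : ∀ u, HasDerivAt
      (fun u => (1 / (π * r ^ 2)) * (u ^ 2 * A u - u ^ 2 * F u - (r ^ 2 - u ^ 2) * u * G u))
      (-(4 * u / r ^ 2) * (1 / (2 * π) * F u)
        - 2 * r * (u / r) * (1 - (u / r) ^ 2) * (1 / (2 * π) * K u)) u := by
    intro u
    have hsq : HasDerivAt (fun u : ℝ => u ^ 2) (2 * u) u := by simpa using hasDerivAt_pow 2 u
    refine ((((hsq.mul (dA u)).sub (hsq.mul (dF u))).sub
      (((hsq.const_sub (r ^ 2)).mul (hasDerivAt_id u)).mul (dG u))).const_mul _).congr_deriv ?_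
    have e1 := relA u
    have e2 := relG u
    simp only [id, Pi.mul_apply]
    change 1 / (π * r ^ 2) * (2 * u * A u + u ^ 2 * _ - (2 * u * F u + u ^ 2 * _)
      - ((-(2 * u) * u + (r ^ 2 - u ^ 2) * 1) * G u + (r ^ 2 - u ^ 2) * u * _)) = _
    revert e1 e2
    generalize (∫ φ in (-π)..π, (-sin φ * fderiv ℝ f (p - u * sin φ, u * cos φ) (1, 0)
        + cos φ * fderiv ℝ f (p - u * sin φ, u * cos φ) (0, 1)) * cos (2 * φ)) = A'
    generalize (∫ φ in (-π)..π, (-sin φ * fderiv ℝ f (p - u * sin φ, u * cos φ) (1, 0)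
        + cos φ * fderiv ℝ f (p - u * sin φ, u * cos φ) (0, 1))) = F'
    generalize (∫ φ in (-π)..π,
      (-sin φ * fderiv ℝ (fun q => fderiv ℝ f q (1, 0)) (p - u * sin φ, u * cos φ) (1, 0)
        + cos φ * fderiv ℝ (fun q => fderiv ℝ f q (1, 0)) (p - u * sin φ, u * cos φ) (0, 1))
        * -sin φ) = G'
    intro e1 e2
    have hpi := pi_ne_zero
    field_simp
    linear_combination 2 * u * e1 - 2 * (r ^ 2 - u ^ 2) * e2
  have hint := intervalIntegral.integral_eq_sub_of_hasDerivAt (a := 0) (b := r)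
    (fun u _ => hprim u) (Continuous.intervalIntegrable (by fun_prop) _ _)
  have hpi := pi_ne_zero
  change 1 / π * A r = 2 * (1 / (2 * π) * F r) + ∫ u in (0 : ℝ)..r,
    (-(4 * u / r ^ 2) * (1 / (2 * π) * F u)
        - 2 * r * (u / r) * (1 - (u / r) ^ 2) * (1 / (2 * π) * K u))
  rw [hint]
  field_simp
  ring
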